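/- Let M ≥ 2 be an integer. For every nonnegative integer N, the number of partitions of N in which every part occurs strictly fewer than M times is equal to the number of partitions of N in which no part is divisible by M. -/

import Mathlib

/-- Counting multisets through `Nat.Partition`. -/
theorem ncard_aux (N : ℕ) (S : Set (Multiset ℕ)) (T : Finset N.Partition)
    (h : ∀ μ, μ ∈ S ↔ ∃ p ∈ T, p.parts = μ) : S.ncard = T.card := by
  have hS : S = Nat.Partition.parts '' (T : Set N.Partition) := by
    ext μ
    simp [h]
  rw [hS, Set.ncard_image_of_injective _ (fun a b hab => Nat.Partition.ext hab),
    Set.ncard_coe_finset]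

/-- Glaisher's theorem.  Let `M ≥ 2`.  For every `N`, the number of
partitions of `N` (multisets of positive integers summing to `N`) in which every part
occurs strictly fewer than `M` times equals the number of partitions of `N` in which no
part is divisible by `M`. -/
theorem stmt7 (M : ℕ) (hM : 2 ≤ M) (N : ℕ) :
    {μ : Multiset ℕ | (∀ x ∈ μ, 0 < x) ∧ μ.sum = N ∧ ∀ x, μ.count x < M}.ncard =
      {μ : Multiset ℕ | (∀ x ∈ μ, 0 < x) ∧ μ.sum = N ∧ ∀ x ∈ μ, ¬ M ∣ x}.ncard := by
  rw [ncard_aux N _ (Nat.Partition.countRestricted N M),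
    ncard_aux N _ (Nat.Partition.restricted N (fun x => ¬ M ∣ x))]
  · exact (Nat.Partition.card_restricted_eq_card_countRestricted N (by omega)).symm
  · intro μ
    simp only [Set.mem_setOf_eq, Nat.Partition.restricted, Finset.mem_filter, Finset.mem_univ,
      true_and]
    constructor
    · rintro ⟨h1, h2, h3⟩
      exact ⟨⟨μ, fun {i} hi => h1 i hi, h2⟩, h3, rfl⟩
    · rintro ⟨p, hp, rfl⟩
      exact ⟨fun x hx => p.parts_pos hx, p.parts_sum, hp⟩
  · intro μ
    simp only [Set.mem_setOf_eq, Nat.Partition.countRestricted, Finset.mem_filter,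
      Finset.mem_univ, true_and]
    constructor
    · rintro ⟨h1, h2, h3⟩
      exact ⟨⟨μ, fun {i} hi => h1 i hi, h2⟩, fun i _ => h3 i, rfl⟩
    · rintro ⟨p, hp, rfl⟩
      refine ⟨fun x hx => p.parts_pos hx, p.parts_sum, fun x => ?_⟩
      by_cases hx : x ∈ p.parts
      · exact hp x hx
      · rw [Multiset.count_eq_zero_of_notMem hx]
        omega
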